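/- Let n ≥ 1, let R be a commutative ring in which 2 = 0, and define Q: R^{2n+1} → R by Q(x) = x_n² + Σ_{i=0}^{n-1} x_i·x_{2n-i} (coordinates indexed 0,…,2n). Let a₀,…,a_{2n} and b₀,…,b_{n-1}, b_{n+1},…,b_{2n} be elements of R, and let A ∈ M_{2n+1}(R) be the matrix with A_{ij} = δ_{ij} for i,j ≠ n, A_{nj} = b_j for j ≠ n, A_{in} = a_i for i ≠ n, and A_{nn} = a_n. Then Q(A·x) = Q(x) for all x ∈ R^{2n+1} if and only if a_i = 0 for all i ≠ n, a_n² = 1, and b_j² = 0 for all j ≠ n. -/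

import Mathlib

open Matrix

/-- The quadratic form `Q(x) = x_n² + Σ_{i=0}^{n-1} x_i x_{2n-i}` on `R^{2n+1}`. -/
def Q2n1 {R : Type*} [CommRing R] (n : ℕ) (x : Fin (2 * n + 1) → R) : R :=
  x ⟨n, by omega⟩ ^ 2 +
    ∑ i : Fin n, x ⟨i, by have := i.isLt; omega⟩ *
      x ⟨2 * n - i, by have := i.isLt; omega⟩

/-- The middle index of `Fin (2n+1)`. -/
def midIdx (n : ℕ) : Fin (2 * n + 1) := ⟨n, by omega⟩

/-- The matrix with `A i j = δ_ij` off the middle row and column, middle column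
    equal to `a`, and middle row off the middle entry equal to `b`. -/
def midMat {R : Type*} [CommRing R] (n : ℕ) (a b : Fin (2 * n + 1) → R) :
    Matrix (Fin (2 * n + 1)) (Fin (2 * n + 1)) R :=
  Matrix.of fun i j =>
    if j = midIdx n then a i
    else if i = midIdx n then b j
    else if i = j then 1 else 0

/-- The hyperbolic part of the quadratic form. -/
def hypS {R : Type*} [CommRing R] (n : ℕ) (x : Fin (2 * n + 1) → R) : R :=
    ∑ i : Fin n, x ⟨i, by have := i.isLt; omega⟩ *
      x ⟨2 * n - i, by have := i.isLt; omega⟩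

/-- The polar form of the hyperbolic part. -/
def hypB {R : Type*} [CommRing R] (n : ℕ) (x y : Fin (2 * n + 1) → R) : R :=
    ∑ i : Fin n, (x ⟨i, by have := i.isLt; omega⟩ * y ⟨2 * n - i, by have := i.isLt; omega⟩ +
      y ⟨i, by have := i.isLt; omega⟩ * x ⟨2 * n - i, by have := i.isLt; omega⟩)

theorem mulVec_off {R : Type*} [CommRing R] (n : ℕ) (a b x : Fin (2 * n + 1) → R)
    (i : Fin (2 * n + 1)) (hi : i ≠ midIdx n) :
    (midMat n a b).mulVec x i = x i + x (midIdx n) * a i := by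
  have h : ∀ j, midMat n a b i j * x j =
      (if j = i then x j else 0) + (if j = midIdx n then x j * a i else 0) := by
    intro j
    simp only [midMat, Matrix.of_apply]
    by_cases h1 : j = midIdx n
    · subst h1
      simp [hi.symm, mul_comm]
    · by_cases h3 : j = i
      · subst h3; simp [h1]
      · simp [h1, hi, h3, Ne.symm h3]
  simp only [Matrix.mulVec, dotProduct, h, Finset.sum_add_distrib]
  simp

theorem mulVec_mid {R : Type*} [CommRing R] (h2 : (2 : R) = 0) (n : ℕ)
    (a b x : Fin (2 * n + 1) → R) :
    ((midMat n a b).mulVec x (midIdx n)) ^ 2 =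
      ∑ j, (if j = midIdx n then a j else b j) ^ 2 * x j ^ 2 := by
  have hs : ∀ s : Finset (Fin (2 * n + 1)), ∀ f : Fin (2 * n + 1) → R,
      (∑ j ∈ s, f j) ^ 2 = ∑ j ∈ s, f j ^ 2 := by
    intro s f
    induction s using Finset.induction_on with
    | empty => simp
    | insert c s hc ih =>
      rw [Finset.sum_insert hc, Finset.sum_insert hc, ← ih]
      linear_combination (f c * ∑ j ∈ s, f j) * h2
  simp only [Matrix.mulVec, dotProduct, hs]
  refine Finset.sum_congr rfl fun j _ => ?_
  by_cases h1 : j = midIdx n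
  · subst h1; simp [midMat, mul_pow]
  · simp [midMat, h1, mul_pow]

theorem key {R : Type*} [CommRing R] (h2 : (2 : R) = 0) (n : ℕ)
    (a b x : Fin (2 * n + 1) → R) :
    Q2n1 n ((midMat n a b).mulVec x) =
      ∑ j, (if j = midIdx n then a j else b j) ^ 2 * x j ^ 2 + (hypS n x
        + x (midIdx n) * hypB n x a + x (midIdx n) ^ 2 * hypS n a) := by
  unfold Q2n1
  rw [← mulVec_mid h2]
  congr 1
  simp only [hypS, hypB, Finset.mul_sum, ← Finset.sum_add_distrib]
  refine Finset.sum_congr rfl fun i _ => ?_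
  have := i.isLt
  rw [mulVec_off, mulVec_off]
  · ring
  · simp only [midIdx, ne_eq, Fin.mk.injEq]; omega
  · simp only [midIdx, ne_eq, Fin.mk.injEq]; omega

theorem hypB_single {R : Type*} [CommRing R] (n : ℕ)
    (a : Fin (2 * n + 1) → R) (i : Fin (2 * n + 1)) (hi : i ≠ midIdx n) :
    hypB n (Pi.single i.rev 1) a = a i := by
  have hi' : i.val ≠ n := fun h => hi (Fin.ext h)
  have hlt := i.isLt
  unfold hypB
  rcases lt_or_gt_of_ne hi' with h | h
  · rw [Finset.sum_eq_single (⟨i.val, h⟩ : Fin n)]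
    · rw [Pi.single_eq_of_ne, show (⟨2 * n - i.val, by omega⟩ : Fin (2 * n + 1)) = i.rev from
        Fin.ext (by simp [Fin.val_rev])]
      · simp
      · intro h'; have := congrArg Fin.val h'; simp [Fin.val_rev] at this; omega
    · intro k _ hk
      have hk' : k.val ≠ i.val := fun h => hk (Fin.ext h)
      have := k.isLt
      rw [Pi.single_eq_of_ne, Pi.single_eq_of_ne]
      · simp
      · intro h'; have := congrArg Fin.val h'; simp [Fin.val_rev] at this; omega
      · intro h'; have := congrArg Fin.val h'; simp [Fin.val_rev] at this; omega
    · simp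
  · rw [Finset.sum_eq_single (⟨2 * n - i.val, by omega⟩ : Fin n)]
    · have e1 : (⟨2 * n - i.val, by omega⟩ : Fin (2 * n + 1)) = i.rev :=
        Fin.ext (by simp [Fin.val_rev])
      have e2 : (⟨2 * n - (2 * n - i.val), by omega⟩ : Fin (2 * n + 1)) = i :=
        Fin.ext (by simp; omega)
      simp only [e1, e2]
      rw [Pi.single_eq_same, Pi.single_eq_of_ne]
      · simp
      · intro h'; have := congrArg Fin.val h'; simp [Fin.val_rev] at this; omega
    · intro k _ hk
      have hk' : k.val ≠ 2 * n - i.val := fun h => hk (Fin.ext h)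
      have := k.isLt
      rw [Pi.single_eq_of_ne, Pi.single_eq_of_ne]
      · simp
      · intro h'; have := congrArg Fin.val h'; simp [Fin.val_rev] at this; omega
      · intro h'; have := congrArg Fin.val h'; simp [Fin.val_rev] at this; omega
    · simp

theorem hyp_zero {R : Type*} [CommRing R] (n : ℕ) (a : Fin (2 * n + 1) → R)
    (ha : ∀ i, i ≠ midIdx n → a i = 0) : hypS n a = 0 ∧ ∀ x, hypB n x a = 0 := by
  have h1 : ∀ i : Fin n, a ⟨i, by have := i.isLt; omega⟩ = 0 := fun i => ha _ (by
    have := i.isLt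
    simp only [midIdx, ne_eq, Fin.mk.injEq]; omega)
  have h3 : ∀ i : Fin n, a ⟨2 * n - i, by have := i.isLt; omega⟩ = 0 := fun i => ha _ (by
    have := i.isLt
    simp only [midIdx, ne_eq, Fin.mk.injEq]; omega)
  constructor
  · simp [hypS, h1]
  · intro x; simp [hypB, h1, h3]

theorem hypB_add {R : Type*} [CommRing R] (n : ℕ) (x y a : Fin (2 * n + 1) → R) :
    hypB n (x + y) a = hypB n x a + hypB n y a := by
  simp only [hypB, ← Finset.sum_add_distrib, Pi.add_apply]
  exact Finset.sum_congr rfl fun i _ => by ring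

theorem sum_single_sq {R : Type*} [CommRing R] (n : ℕ) (c : Fin (2 * n + 1) → R)
    (j : Fin (2 * n + 1)) :
    ∑ k, c k ^ 2 * (Pi.single j (1 : R) : Fin (2 * n + 1) → R) k ^ 2 = c j ^ 2 := by
  rw [Finset.sum_eq_single j]
  · simp
  · intro k _ hk; simp [Pi.single_eq_of_ne hk]
  · simp

theorem stmt_12 {R : Type*} [CommRing R] (h2 : (2 : R) = 0) (n : ℕ) (hn : 1 ≤ n)
    (a b : Fin (2 * n + 1) → R) :
    (∀ x : Fin (2 * n + 1) → R, Q2n1 n ((midMat n a b).mulVec x) = Q2n1 n x) ↔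
      (∀ i, i ≠ midIdx n → a i = 0) ∧ a (midIdx n) ^ 2 = 1 ∧
        (∀ j, j ≠ midIdx n → b j ^ 2 = 0) := by
  have hQ : ∀ x : Fin (2 * n + 1) → R, Q2n1 n x = x (midIdx n) ^ 2 + hypS n x := fun _ => rfl
  simp only [key h2, hQ]
  constructor
  · intro h
    have hb : ∀ j, j ≠ midIdx n → b j ^ 2 = 0 := by
      intro j hj
      have := h (Pi.single j 1)
      rw [sum_single_sq, Pi.single_eq_of_ne hj.symm, if_neg hj] at this
      linear_combination this
    have hm := h (Pi.single (midIdx n) 1)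
    rw [sum_single_sq, Pi.single_eq_same, if_pos rfl] at hm
    have ha : ∀ i, i ≠ midIdx n → a i = 0 := by
      intro i hi
      have hr : i.rev ≠ midIdx n := by
        intro h'
        apply hi
        have h3 := congrArg Fin.val h'
        have := i.isLt
        simp only [midIdx, Fin.val_rev] at h3
        exact Fin.ext (by simp only [midIdx]; omega)
      have h3 := h (Pi.single (midIdx n) 1 + Pi.single i.rev 1)
      have h4 : ∑ k, (if k = midIdx n then a k else b k) ^ 2 *
          ((Pi.single (midIdx n) 1 + Pi.single i.rev 1 : Fin (2 * n + 1) → R) k) ^ 2 =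
          a (midIdx n) ^ 2 + b i.rev ^ 2 := by
        have e1 := sum_single_sq n (fun k => if k = midIdx n then a k else b k) (midIdx n)
        have e2 := sum_single_sq n (fun k => if k = midIdx n then a k else b k) i.rev
        simp only [if_neg hr, if_true] at e1 e2
        rw [← e1, ← e2, ← Finset.sum_add_distrib]
        refine Finset.sum_congr rfl fun k _ => ?_
        rw [Pi.add_apply]
        generalize (Pi.single (midIdx n) 1 : Fin (2 * n + 1) → R) k = u
        generalize (Pi.single i.rev 1 : Fin (2 * n + 1) → R) k = v
        generalize (if k = midIdx n then a k else b k) = c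
        linear_combination c ^ 2 * u * v * h2
      rw [h4, hypB_add, hypB_single n a i hi, Pi.add_apply, Pi.single_eq_same,
        Pi.single_eq_of_ne hr.symm, hb _ hr] at h3
      linear_combination h3 - hm
    obtain ⟨hS, hB⟩ := hyp_zero n a ha
    refine ⟨ha, ?_, hb⟩
    rw [hS, hB] at hm
    linear_combination hm
  · rintro ⟨ha, hm, hb⟩ x
    obtain ⟨hS, hB⟩ := hyp_zero n a ha
    rw [hS, hB, Finset.sum_eq_single (midIdx n)]
    · rw [if_pos rfl, hm]; ring
    · intro j _ hj
      rw [if_neg hj, hb j hj, zero_mul]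
    · simp
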